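/- arXiv:2602.06209 — 7 statements merged into one kernel-verified Lean document; each statement's English description precedes it below -/
import Mathlib

section
/- Let K be a commutative ring and R an associative unital K-algebra, let f ∈ R, and let G ⊆ R be a subset with Algebra.adjoin K G = ⊤. Assume that for every g ∈ G the commutator g*f − f*g commutes with f. Let M be a left R-module and S an R-submodule of M. Then the saturation Sat(S,f) := {m ∈ M | ∃ j : ℕ, f^j • m ∈ S} is an R-submodule of M containing S. -/
/-- If the commutator of `g` and `f` commutes with `f`, then powers of `f` move past `g`
at the cost of one factor `f`. -/
theorem pow_succ_mul_eq_of_commute_commutator {R : Type*} [Ring R] {f g : R}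
    (h : Commute (g * f - f * g) f) (j : ℕ) :
    f ^ (j + 1) * g = (g * f - (j + 1) • (g * f - f * g)) * f ^ j := by
  induction j with
  | zero => simp
  | succ j ih =>
    have h₁ : f * (g * f - (j + 1) • (g * f - f * g)) =
        (g * f - (j + 1 + 1) • (g * f - f * g)) * f := by
      rw [mul_sub, mul_smul_comm, ← h.eq, ← smul_mul_assoc, succ_nsmul _ (j + 1)]
      generalize (j + 1) • (g * f - f * g) = d
      noncomm_ring
    rw [pow_succ' f (j + 1), mul_assoc, ih, ← mul_assoc, h₁, mul_assoc, ← pow_succ']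

theorem Submodule.pow_smul_mem_of_le {R M : Type*} [Semiring R] [AddCommMonoid M] [Module R M]
    (S : Submodule R M) {f : R} {m : M} {i j : ℕ} (hij : i ≤ j) (h : f ^ i • m ∈ S) :
    f ^ j • m ∈ S := by
  rw [← Nat.sub_add_cancel hij, pow_add, mul_smul]
  exact S.smul_mem _ h

/-- The left saturation `{m | ∃ j, f^j • m ∈ S}` of a submodule `S` with respect to `f`
is again a submodule, and it contains `S`. -/
theorem saturation_is_submodule
    (K R M : Type*) [CommRing K] [Ring R] [Algebra K R]
    [AddCommGroup M] [Module R M]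
    (f : R) (G : Set R) (hG : Algebra.adjoin K G = ⊤)
    (hcomm : ∀ g ∈ G, Commute (g * f - f * g) f)
    (S : Submodule R M) :
    ∃ T : Submodule R M,
      (T : Set M) = {m : M | ∃ j : ℕ, f ^ j • m ∈ S} ∧ S ≤ T := by
  have hadd : ∀ {a b : M}, (∃ j : ℕ, f ^ j • a ∈ S) → (∃ j : ℕ, f ^ j • b ∈ S) →
      ∃ j : ℕ, f ^ j • (a + b) ∈ S := by
    rintro a b ⟨i, hi⟩ ⟨j, hj⟩
    refine ⟨max i j, ?_⟩
    rw [smul_add]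
    exact S.add_mem (S.pow_smul_mem_of_le (le_max_left i j) hi)
      (S.pow_smul_mem_of_le (le_max_right i j) hj)
  have hsmul : ∀ (r : R) (m : M), (∃ j : ℕ, f ^ j • m ∈ S) → ∃ j : ℕ, f ^ j • r • m ∈ S := by
    intro r
    have hr : r ∈ Algebra.adjoin K G := hG ▸ Algebra.mem_top
    induction hr using Algebra.adjoin_induction with
    | mem g hg =>
      rintro m ⟨j, hj⟩
      refine ⟨j + 1, ?_⟩
      rw [smul_smul, pow_succ_mul_eq_of_commute_commutator (hcomm g hg), mul_smul]
      exact S.smul_mem _ hj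
    | algebraMap k =>
      rintro m ⟨j, hj⟩
      refine ⟨j, ?_⟩
      rw [smul_smul, ← Algebra.commutes, mul_smul]
      exact S.smul_mem _ hj
    | add x y _ _ hx hy =>
      intro m hm
      rw [add_smul]
      exact hadd (hx m hm) (hy m hm)
    | mul x y _ _ hx hy =>
      intro m hm
      rw [mul_smul]
      exact hx _ (hy m hm)
  refine ⟨{ carrier := {m | ∃ j : ℕ, f ^ j • m ∈ S}
            add_mem' := hadd
            zero_mem' := ⟨0, by simp⟩
            smul_mem' := hsmul }, rfl, fun m hm => ⟨0, by simpa using hm⟩⟩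
end

section
/- For every f ∈ P, the multiplication operator m_f lies in W; and for every positive integer r and every W-submodule S of the left W-module (Fin r → W), the set {L ∈ (Fin r → W) | ∃ j : ℕ, (fun i => m_f^j ∘ L i) ∈ S} is a W-submodule of (Fin r → W). -/
set_option synthInstance.maxHeartbeats 1000000
set_option maxHeartbeats 1000000
open MvPolynomial

/-- Commuting a power of a multiplication operator past a derivation. -/
theorem Derivation.mulLeft_pow_succ_mul {R A : Type*} [CommRing R] [CommRing A] [Algebra R A]
    (D : Derivation R A A) (f : A) (j : ℕ) :
    LinearMap.mulLeft R f ^ (j + 1) * D.toLinearMap =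
      (D.toLinearMap * LinearMap.mulLeft R f - LinearMap.mulLeft R ((j + 1) • D f)) *
        LinearMap.mulLeft R f ^ j := by
  ext p
  have h : f * (f ^ j * p) = f ^ (j + 1) * p := by ring
  simp only [LinearMap.pow_mulLeft, Module.End.mul_apply, LinearMap.sub_apply,
    LinearMap.mulLeft_apply,
    Derivation.coeFn_coe, h, Derivation.leibniz, Derivation.leibniz_pow, smul_eq_mul,
    nsmul_eq_mul, Nat.add_sub_cancel]
  push_cast
  ring

/-- A subalgebra containing multiplication by the variables contains multiplication by every
polynomial. -/
theorem MvPolynomial.mulLeft_mem_of_mulLeft_X_mem {R σ : Type*} [CommRing R]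
    {W : Subalgebra R (Module.End R (MvPolynomial σ R))}
    (hX : ∀ i, LinearMap.mulLeft R (X i) ∈ W) (f : MvPolynomial σ R) :
    LinearMap.mulLeft R f ∈ W := by
  have h : W.comap (Algebra.lmul R (MvPolynomial σ R)) = ⊤ := by
    rw [← top_le_iff, ← MvPolynomial.adjoin_range_X, Algebra.adjoin_le_iff]
    rintro _ ⟨i, rfl⟩
    exact hX i
  exact (h ▸ Algebra.mem_top : f ∈ W.comap (Algebra.lmul R (MvPolynomial σ R)))

/-- `a` can be moved to the left of powers of `F`, inside the subalgebra `W`, at the cost of a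
bounded number of extra factors `F`. -/
def IsOreMovable {R A : Type*} [CommRing R] [Ring A] [Algebra R A] (W : Subalgebra R A)
    (F a : A) : Prop :=
  ∃ k : ℕ, ∀ j : ℕ, ∃ b ∈ W, F ^ (j + k) * a = b * F ^ j

namespace IsOreMovable

variable {R A : Type*} [CommRing R] [Ring A] [Algebra R A] {W : Subalgebra R A} {F a b : A}

theorem of_commute (ha : a ∈ W) (h : Commute F a) : IsOreMovable W F a :=
  ⟨0, fun j => ⟨a, ha, (h.pow_left j).eq⟩⟩

theorem add (hF : F ∈ W) (ha : IsOreMovable W F a) (hb : IsOreMovable W F b) :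
    IsOreMovable W F (a + b) := by
  obtain ⟨k, hk⟩ := ha
  obtain ⟨l, hl⟩ := hb
  refine ⟨k + l, fun j => ?_⟩
  obtain ⟨c, hc, hac⟩ := hk j
  obtain ⟨d, hd, hbd⟩ := hl j
  refine ⟨F ^ l * c + F ^ k * d,
    W.add_mem (W.mul_mem (W.pow_mem hF l) hc) (W.mul_mem (W.pow_mem hF k) hd), ?_⟩
  rw [mul_add, add_mul, mul_assoc, mul_assoc, ← hac, ← hbd, ← mul_assoc, ← mul_assoc,
    ← pow_add, ← pow_add, show l + (j + k) = j + (k + l) by ring,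
    show k + (j + l) = j + (k + l) by ring]

theorem mul (ha : IsOreMovable W F a) (hb : IsOreMovable W F b) :
    IsOreMovable W F (a * b) := by
  obtain ⟨k, hk⟩ := ha
  obtain ⟨l, hl⟩ := hb
  refine ⟨l + k, fun j => ?_⟩
  obtain ⟨d, hd, hbd⟩ := hl j
  obtain ⟨c, hc, hac⟩ := hk (j + l)
  refine ⟨c * d, W.mul_mem hc hd, ?_⟩
  rw [← add_assoc, ← mul_assoc, hac, mul_assoc, hbd, mul_assoc]

theorem of_mem_adjoin {s : Set A} (hF : F ∈ W) (hs : ∀ x ∈ s, IsOreMovable W F x)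
    (ha : a ∈ Algebra.adjoin R s) : IsOreMovable W F a := by
  induction ha using Algebra.adjoin_induction with
  | mem x hx => exact hs x hx
  | algebraMap r => exact of_commute (W.algebraMap_mem r) (Algebra.commutes r F).symm
  | add x y _ _ hx hy => exact hx.add hF hy
  | mul x y _ _ hx hy => exact hx.mul hy

end IsOreMovable

/-- The saturation of a left submodule with respect to the powers of an element satisfying
the left Ore condition. -/
def Submodule.leftSaturation {A M : Type*} [Semiring A] [AddCommMonoid M] [Module A M]
    (S : Submodule A M) (F : A) (h : ∀ (a : A) (j : ℕ), ∃ (k : ℕ) (b : A), F ^ k * a = b * F ^ j) :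
    Submodule A M where
  carrier := {x | ∃ j : ℕ, F ^ j • x ∈ S}
  zero_mem' := ⟨0, by simp⟩
  add_mem' := by
    rintro x y ⟨j, hx⟩ ⟨k, hy⟩
    refine ⟨j + k, ?_⟩
    rw [smul_add]
    refine S.add_mem ?_ ?_
    · rw [add_comm, pow_add, mul_smul]
      exact S.smul_mem _ hx
    · rw [pow_add, mul_smul]
      exact S.smul_mem _ hy
  smul_mem' := by
    rintro a x ⟨j, hx⟩
    obtain ⟨k, b, hb⟩ := h a j
    refine ⟨k, ?_⟩
    rw [← mul_smul, hb, mul_smul]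
    exact S.smul_mem _ hx

/-- In the polynomial Weyl algebra `W` (realized as differential operators on
`P = K[x₁,…,xₙ]`), every multiplication operator `m_f` lies in `W`, and the
saturation of a `W`-submodule `S` of `W^r` with respect to `f` is a `W`-submodule. -/
theorem weyl_saturation_is_submodule
    (K : Type*) [Field K] [CharZero K] (n : ℕ) (hn : 0 < n)
    (W : Subalgebra K (Module.End K (MvPolynomial (Fin n) K)))
    (hW : W = Algebra.adjoin K
      ((Set.range fun i : Fin n => LinearMap.mulLeft K (X i)) ∪
       (Set.range fun i : Fin n => (pderiv (R := K) i).toLinearMap)))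
    (f : MvPolynomial (Fin n) K) :
    ∃ hf : LinearMap.mulLeft K f ∈ W,
      ∀ (r : ℕ), 0 < r → ∀ S : Submodule W (Fin r → W),
        ∃ T : Submodule W (Fin r → W),
          (T : Set (Fin r → W)) =
            {L : Fin r → W | ∃ j : ℕ,
              (fun i : Fin r => (⟨LinearMap.mulLeft K f, hf⟩ : W) ^ j * L i) ∈ S} := by
  have hX (i : Fin n) : LinearMap.mulLeft K (X i : MvPolynomial (Fin n) K) ∈ W :=
    hW ▸ Algebra.subset_adjoin (Or.inl ⟨i, rfl⟩)
  have hD (i : Fin n) : (pderiv (R := K) i).toLinearMap ∈ W :=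
    hW ▸ Algebra.subset_adjoin (Or.inr ⟨i, rfl⟩)
  have hmul := mulLeft_mem_of_mulLeft_X_mem hX
  have hOre : ∀ a ∈ W, IsOreMovable W (LinearMap.mulLeft K f) a := by
    intro a ha
    rw [hW] at ha
    refine IsOreMovable.of_mem_adjoin (hmul f) ?_ ha
    rintro _ (⟨i, rfl⟩ | ⟨i, rfl⟩)
    · refine IsOreMovable.of_commute (hX i) ?_
      exact LinearMap.ext fun p => mul_left_comm f (X i) p
    · exact ⟨1, fun j => ⟨_, W.sub_mem (W.mul_mem (hD i) (hmul f))
        (hmul ((j + 1) • pderiv i f)),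
        (pderiv i).mulLeft_pow_succ_mul f j⟩⟩
  have hOreW (a : W) (j : ℕ) : ∃ (k : ℕ) (b : W),
      (⟨LinearMap.mulLeft K f, hmul f⟩ : W) ^ k * a = b * ⟨LinearMap.mulLeft K f, hmul f⟩ ^ j := by
    obtain ⟨k, hk⟩ := hOre a a.2
    obtain ⟨b, hb, hab⟩ := hk j
    exact ⟨j + k, ⟨b, hb⟩, Subtype.ext hab⟩
  refine ⟨hmul f, fun r _ S => ⟨S.leftSaturation _ hOreW, ?_⟩⟩
  rfl
end

section
/- For every a ∈ A there exists b ∈ A with a ∘ m_{f·T − 1} = m_{f·T − 1} ∘ b, and for every a ∈ A there exists b ∈ A with m_{f·T − 1} ∘ a = b ∘ m_{f·T − 1}. Consequently the left ideal of A generated by m_{f·T − 1} equals the right ideal of A generated by m_{f·T − 1}. -/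
set_option synthInstance.maxHeartbeats 1000000
set_option maxHeartbeats 1000000

open MvPolynomial

noncomputable section

variable (K : Type*) [Field K] [CharZero K] (n : ℕ)

/-- The polynomial ring `K[x₁,…,xₙ,T]`. -/
abbrev Qring := MvPolynomial (Fin n ⊕ Unit) K

/-- The operator of multiplication by a polynomial `q`. -/
def mQ (q : Qring K n) : Module.End K (Qring K n) := LinearMap.mulLeft K q

/-- The variable `T`. -/
def Tvar : Qring K n := X (Sum.inr ())

/-- The twisted partial derivative `D_i = ∂_{x_i} - m_{f_i·T²} ∘ ∂_T`. -/
def Dop (f : Qring K n) (i : Fin n) : Module.End K (Qring K n) :=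
  (pderiv (R := K) (Sum.inl i)).toLinearMap -
    mQ K n (pderiv (Sum.inl i) f * Tvar K n ^ 2) * (pderiv (R := K) (Sum.inr ())).toLinearMap

/-- The realization of the Weyl algebra `W_x`, generated by the `m_{x_i}` and the `D_i`. -/
def Wsub (f : Qring K n) : Subalgebra K (Module.End K (Qring K n)) :=
  Algebra.adjoin K
    ((Set.range fun i : Fin n => mQ K n (X (Sum.inl i))) ∪ Set.range (Dop K n f))

/-- The realization of the extended algebra `W_x[T]`, generated by the `m_{x_i}`,
the `D_i` and `m_T`. -/
def Asub (f : Qring K n) : Subalgebra K (Module.End K (Qring K n)) :=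
  Algebra.adjoin K
    ((Set.range fun i : Fin n => mQ K n (X (Sum.inl i))) ∪ Set.range (Dop K n f) ∪
      {mQ K n (Tvar K n)})

section Normalizing

variable {R S : Type*} [CommSemiring R] [Semiring S] [Algebra R S]

/-- If every generator of an algebra can be moved from the left of `g` to its right, so can every
element. -/
theorem exists_mul_eq_mul_of_mem_adjoin {s : Set S} {g : S}
    (h : ∀ a ∈ s, ∃ b ∈ Algebra.adjoin R s, a * g = g * b) {a : S}
    (ha : a ∈ Algebra.adjoin R s) : ∃ b ∈ Algebra.adjoin R s, a * g = g * b := by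
  induction ha using Algebra.adjoin_induction with
  | mem a ha => exact h a ha
  | algebraMap r => exact ⟨_, Subalgebra.algebraMap_mem _ r, Algebra.commutes r g⟩
  | add a₁ a₂ _ _ h₁ h₂ =>
    obtain ⟨b₁, hb₁, e₁⟩ := h₁
    obtain ⟨b₂, hb₂, e₂⟩ := h₂
    exact ⟨b₁ + b₂, add_mem hb₁ hb₂, by rw [add_mul, mul_add, e₁, e₂]⟩
  | mul a₁ a₂ _ _ h₁ h₂ =>
    obtain ⟨b₁, hb₁, e₁⟩ := h₁
    obtain ⟨b₂, hb₂, e₂⟩ := h₂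
    exact ⟨b₁ * b₂, mul_mem hb₁ hb₂, by rw [mul_assoc, e₂, ← mul_assoc, e₁, mul_assoc]⟩

/-- If every generator of an algebra can be moved from the right of `g` to its left, so can every
element. -/
theorem exists_mul_eq_mul_of_mem_adjoin' {s : Set S} {g : S}
    (h : ∀ a ∈ s, ∃ b ∈ Algebra.adjoin R s, g * a = b * g) {a : S}
    (ha : a ∈ Algebra.adjoin R s) : ∃ b ∈ Algebra.adjoin R s, g * a = b * g := by
  induction ha using Algebra.adjoin_induction with
  | mem a ha => exact h a ha
  | algebraMap r => exact ⟨_, Subalgebra.algebraMap_mem _ r, (Algebra.commutes r g).symm⟩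
  | add a₁ a₂ _ _ h₁ h₂ =>
    obtain ⟨b₁, hb₁, e₁⟩ := h₁
    obtain ⟨b₂, hb₂, e₂⟩ := h₂
    exact ⟨b₁ + b₂, add_mem hb₁ hb₂, by rw [add_mul, mul_add, e₁, e₂]⟩
  | mul a₁ a₂ _ _ h₁ h₂ =>
    obtain ⟨b₁, hb₁, e₁⟩ := h₁
    obtain ⟨b₂, hb₂, e₂⟩ := h₂
    exact ⟨b₁ * b₂, mul_mem hb₁ hb₂, by rw [← mul_assoc, e₁, mul_assoc, e₂, mul_assoc]⟩

end Normalizing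

section Operators

variable {K n}

omit [CharZero K] in
theorem mQ_mul (p q : Qring K n) : mQ K n (p * q) = mQ K n p * mQ K n q :=
  LinearMap.mulLeft_mul K _ p q

omit [CharZero K] in
theorem mQ_mul_comm (p q : Qring K n) : mQ K n p * mQ K n q = mQ K n q * mQ K n p := by
  rw [← mQ_mul, mul_comm, mQ_mul]

omit [CharZero K] in
/-- The algebra `W_x[T]` contains all multiplication operators. -/
theorem mQ_mem_Asub (f q : Qring K n) : mQ K n q ∈ Asub K n f := by
  induction q using MvPolynomial.induction_on with
  | C r =>
    convert Subalgebra.algebraMap_mem (Asub K n f) r using 1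
    refine LinearMap.ext fun p => ?_
    simp [mQ, MvPolynomial.C_mul', Module.algebraMap_end_apply]
  | add p q hp hq =>
    convert add_mem hp hq using 1
    exact map_add (LinearMap.mul K (Qring K n)) p q
  | mul_X p i hp =>
    rw [mQ_mul]
    refine mul_mem hp (Algebra.subset_adjoin ?_)
    rcases i with i | ⟨⟩
    · exact Or.inl (Or.inl ⟨i, rfl⟩)
    · exact Or.inr rfl

omit [CharZero K] in
theorem Dop_mem_Asub (f : Qring K n) (i : Fin n) : Dop K n f i ∈ Asub K n f :=
  Algebra.subset_adjoin (Or.inl (Or.inr ⟨i, rfl⟩))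

omit [CharZero K] in
/-- The operator `D_i` is a derivation with `D_i (fT - 1) = -f_i T (fT - 1)`. -/
theorem Dop_mul_mQ {f : Qring K n} (hfT : pderiv (Sum.inr ()) f = 0) (i : Fin n) :
    Dop K n f i * mQ K n (f * Tvar K n - 1) =
      mQ K n (f * Tvar K n - 1) * (Dop K n f i - mQ K n (pderiv (Sum.inl i) f * Tvar K n)) := by
  refine LinearMap.ext fun p => ?_
  have h₁ : pderiv (R := K) (Sum.inl i) (Tvar K n) = 0 := pderiv_X_of_ne (by simp)
  have h₂ : pderiv (R := K) (Sum.inr ()) (Tvar K n) = 1 := pderiv_X_self _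
  simp only [Dop, mQ, Module.End.mul_apply, LinearMap.sub_apply, LinearMap.mulLeft_apply,
    Derivation.coeFn_coe, Derivation.leibniz, map_sub,
    Derivation.map_one_eq_zero, h₁, h₂, hfT, smul_eq_mul]
  ring

end Operators

/-- The two "normalizing" properties of `m_{fT-1}` with respect to elements of `A`,
and the consequence that the left and right ideals of `A` generated by `m_{fT-1}`
coincide. -/
theorem twoSided_mfT_sub_one
    (hn : 0 < n) (f : Qring K n) (hfT : pderiv (Sum.inr ()) f = 0) :
    (∀ a ∈ Asub K n f, ∃ b ∈ Asub K n f,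
        a * mQ K n (f * Tvar K n - 1) = mQ K n (f * Tvar K n - 1) * b) ∧
    (∀ a ∈ Asub K n f, ∃ b ∈ Asub K n f,
        mQ K n (f * Tvar K n - 1) * a = b * mQ K n (f * Tvar K n - 1)) ∧
    {x : Module.End K (Qring K n) | ∃ a ∈ Asub K n f, x = a * mQ K n (f * Tvar K n - 1)} =
      {x : Module.End K (Qring K n) | ∃ a ∈ Asub K n f, x = mQ K n (f * Tvar K n - 1) * a} := by
  have left : ∀ a ∈ Asub K n f, ∃ b ∈ Asub K n f,
      a * mQ K n (f * Tvar K n - 1) = mQ K n (f * Tvar K n - 1) * b := by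
    refine fun a => exists_mul_eq_mul_of_mem_adjoin ?_
    rintro _ ((⟨i, rfl⟩ | ⟨i, rfl⟩) | rfl)
    · exact ⟨_, mQ_mem_Asub f _, mQ_mul_comm _ _⟩
    · exact ⟨_, sub_mem (Dop_mem_Asub f i) (mQ_mem_Asub f _), Dop_mul_mQ hfT i⟩
    · exact ⟨_, mQ_mem_Asub f _, mQ_mul_comm _ _⟩
  have right : ∀ a ∈ Asub K n f, ∃ b ∈ Asub K n f,
      mQ K n (f * Tvar K n - 1) * a = b * mQ K n (f * Tvar K n - 1) := by
    refine fun a => exists_mul_eq_mul_of_mem_adjoin' ?_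
    rintro _ ((⟨i, rfl⟩ | ⟨i, rfl⟩) | rfl)
    · exact ⟨_, mQ_mem_Asub f _, mQ_mul_comm _ _⟩
    · refine ⟨_, add_mem (Dop_mem_Asub f i)
        (mQ_mem_Asub f (pderiv (Sum.inl i) f * Tvar K n)), ?_⟩
      rw [add_mul, Dop_mul_mQ hfT, mul_sub, mQ_mul_comm (pderiv (Sum.inl i) f * Tvar K n),
        sub_add_cancel]
    · exact ⟨_, mQ_mem_Asub f _, mQ_mul_comm _ _⟩
  refine ⟨left, right, Set.ext fun x => ⟨?_, ?_⟩⟩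
  · rintro ⟨a, ha, rfl⟩
    exact left a ha
  · rintro ⟨a, ha, rfl⟩
    exact right a ha

end
end

section
/- In Module.End K Q, for every i ∈ Fin n: D_i ∘ m_{f·T − 1} = m_{f·T − 1} ∘ (D_i − m_{T·f_i}) and m_{f·T − 1} ∘ D_i = (D_i + m_{T·f_i}) ∘ m_{f·T − 1}. -/
set_option synthInstance.maxHeartbeats 1000000
set_option maxHeartbeats 1000000

open MvPolynomial

noncomputable section

variable (K : Type*) [Field K] [CharZero K] (n : ℕ)

/-- The operator `D_i` past multiplication by `fT - 1`, evaluated at a polynomial. -/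
theorem Dop_mul_apply (f : Qring K n) (hfT : pderiv (Sum.inr ()) f = 0) (i : Fin n)
    (p : Qring K n) :
    Dop K n f i ((f * Tvar K n - 1) * p) =
      (f * Tvar K n - 1) * (Dop K n f i p - Tvar K n * pderiv (Sum.inl i) f * p) := by
  have hx : pderiv (R := K) (Sum.inl i) (Tvar K n) = 0 :=
    pderiv_X_of_ne (by simp)
  have hT : pderiv (R := K) (Sum.inr ()) (Tvar K n) = 1 := pderiv_X_self _
  simp only [Dop, mQ, LinearMap.sub_apply, Module.End.mul_apply, LinearMap.mulLeft_apply,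
    Derivation.coeFn_coe, Derivation.leibniz, map_sub,
    Derivation.map_one_eq_zero, smul_eq_mul, hx, hT, hfT]
  ring

/-- The commutation identities
`D_i ∘ m_{fT-1} = m_{fT-1} ∘ (D_i - m_{T·f_i})` and
`m_{fT-1} ∘ D_i = (D_i + m_{T·f_i}) ∘ m_{fT-1}`. -/
theorem commutation_with_mfT_sub_one
    (hn : 0 < n) (f : Qring K n) (hfT : pderiv (Sum.inr ()) f = 0) :
    ∀ i : Fin n,
      Dop K n f i * mQ K n (f * Tvar K n - 1) =
        mQ K n (f * Tvar K n - 1) *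
          (Dop K n f i - mQ K n (Tvar K n * pderiv (Sum.inl i) f)) ∧
      mQ K n (f * Tvar K n - 1) * Dop K n f i =
        (Dop K n f i + mQ K n (Tvar K n * pderiv (Sum.inl i) f)) *
          mQ K n (f * Tvar K n - 1) := by
  intro i
  constructor <;> refine LinearMap.ext fun p => ?_
  · exact Dop_mul_apply K n f hfT i p
  · change (f * Tvar K n - 1) * Dop K n f i p =
      Dop K n f i ((f * Tvar K n - 1) * p) +
        Tvar K n * pderiv (Sum.inl i) f * ((f * Tvar K n - 1) * p)
    rw [Dop_mul_apply K n f hfT i p]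
    ring

end
end

section
/- In Module.End K Q, for all i, j ∈ Fin n: D_i ∘ m_{x_j} − m_{x_j} ∘ D_i equals the identity if i = j and zero otherwise; D_i ∘ D_j = D_j ∘ D_i; and D_i ∘ m_T = m_T ∘ D_i − m_{f_i·T^2}. -/
set_option synthInstance.maxHeartbeats 1000000
set_option maxHeartbeats 1000000

open MvPolynomial

noncomputable section

variable (K : Type*) [Field K] [CharZero K] (n : ℕ)

theorem pderiv_comm {R σ : Type*} [CommRing R] (i j : σ) (p : MvPolynomial σ R) :
    pderiv i (pderiv j p) = pderiv j (pderiv i p) := by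
  classical
  have h : ⁅pderiv (R := R) i, pderiv (R := R) j⁆ = 0 := by
    refine MvPolynomial.derivation_ext fun k => ?_
    simp [Derivation.commutator_apply, pderiv_X, Pi.single_apply, apply_ite]
  simpa [Derivation.commutator_apply, sub_eq_zero] using congrArg (fun D => D p) h

omit [CharZero K] in
theorem mQ_apply (q p : Qring K n) : mQ K n q p = q * p := rfl

omit [CharZero K] in
theorem Dop_apply (f : Qring K n) (i : Fin n) (p : Qring K n) :
    Dop K n f i p = pderiv (Sum.inl i) p -
      pderiv (Sum.inl i) f * Tvar K n ^ 2 * pderiv (Sum.inr ()) p := rfl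

omit [CharZero K] in
theorem pderiv_inl_Tvar (i : Fin n) : pderiv (Sum.inl i) (Tvar K n) = 0 :=
  pderiv_X_of_ne Sum.inr_ne_inl

omit [CharZero K] in
theorem pderiv_inr_Tvar : pderiv (Sum.inr ()) (Tvar K n) = 1 :=
  pderiv_X_self _

omit [CharZero K] in
theorem pderiv_inl_X_inl (i j : Fin n) :
    pderiv (Sum.inl i) (X (Sum.inl j) : Qring K n) = if i = j then 1 else 0 := by
  classical
  simp [pderiv_X, Pi.single_apply, eq_comm]

omit [CharZero K] in
theorem pderiv_inr_X_inl (j : Fin n) :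
    pderiv (Sum.inr ()) (X (Sum.inl j) : Qring K n) = 0 :=
  pderiv_X_of_ne Sum.inl_ne_inr

/-- The operators `m_{x_i}`, `D_i`, `m_T` satisfy the defining relations of the
algebra `W_x[T]`: the Weyl relations together with `D_i ∘ m_T = m_T ∘ D_i - m_{f_i·T²}`. -/
theorem defining_relations_of_WxT
    (hn : 0 < n) (f : Qring K n) (hfT : pderiv (Sum.inr ()) f = 0) :
    ∀ i j : Fin n,
      (Dop K n f i * mQ K n (X (Sum.inl j)) - mQ K n (X (Sum.inl j)) * Dop K n f i =
        if i = j then 1 else 0) ∧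
      Dop K n f i * Dop K n f j = Dop K n f j * Dop K n f i ∧
      Dop K n f i * mQ K n (Tvar K n) =
        mQ K n (Tvar K n) * Dop K n f i -
          mQ K n (pderiv (Sum.inl i) f * Tvar K n ^ 2) := by
  intro i j
  refine ⟨LinearMap.ext fun p => ?_, LinearMap.ext fun p => ?_, LinearMap.ext fun p => ?_⟩
  · simp only [LinearMap.sub_apply, Module.End.mul_apply, mQ_apply, Dop_apply, pderiv_mul,
      pderiv_inl_X_inl, pderiv_inr_X_inl]
    split_ifs
    · rw [Module.End.one_apply]
      ring
    · rw [LinearMap.zero_apply]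
      ring
  · have hT (k : Fin n) : pderiv (Sum.inr ()) (pderiv (Sum.inl k) f) = 0 := by
      rw [pderiv_comm, hfT, map_zero]
    simp only [Module.End.mul_apply, Dop_apply, map_sub, pderiv_mul, pderiv_pow, hT,
      pderiv_inl_Tvar, pderiv_inr_Tvar]
    rw [pderiv_comm (Sum.inl j) (Sum.inl i) p, pderiv_comm (Sum.inl j) (Sum.inl i) f,
      pderiv_comm (Sum.inl i) (Sum.inr ()) p, pderiv_comm (Sum.inl j) (Sum.inr ()) p]
    ring
  · simp only [LinearMap.sub_apply, Module.End.mul_apply, mQ_apply, Dop_apply, pderiv_mul,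
      pderiv_inl_Tvar, pderiv_inr_Tvar]
    ring

end
end

section
/- Every element a ∈ A can be written as a finite sum a = Σ_{j=0}^{ℓ} m_T^j ∘ w_j with w_0, …, w_ℓ ∈ W; moreover this representation is unique: if Σ_{j=0}^{ℓ} m_T^j ∘ w_j = 0 with all w_j ∈ W, then w_j = 0 for every j. -/
set_option synthInstance.maxHeartbeats 1000000
set_option maxHeartbeats 1000000

open MvPolynomial

noncomputable section

variable (K : Type*) [Field K] [CharZero K] (n : ℕ)

set_option linter.unusedSectionVars false

/-- A submodule containing `1` and stable under left multiplication by `G` contains the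
subalgebra generated by `G`. -/
theorem mem_of_mem_adjoin_of_mul_mem {R E : Type*} [CommRing R] [Ring E] [Algebra R E]
    {G : Set E} {S : Submodule R E} (one_mem : 1 ∈ S) (mul_mem : ∀ a ∈ G, ∀ s ∈ S, a * s ∈ S)
    {a : E} (ha : a ∈ Algebra.adjoin R G) : a ∈ S := by
  suffices h : ∀ s ∈ S, a * s ∈ S by simpa using h 1 one_mem
  induction ha using Algebra.adjoin_induction with
  | mem a ha => exact mul_mem a ha
  | algebraMap r =>
    intro s hs
    rw [← Algebra.smul_def]
    exact S.smul_mem r hs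
  | add a b _ _ ha hb =>
    intro s hs
    rw [add_mul]
    exact add_mem (ha s hs) (hb s hs)
  | mul a b _ _ ha hb =>
    intro s hs
    rw [mul_assoc]
    exact ha _ (hb s hs)

/-- Normal form in an algebra with Weyl relations: coefficients on the left, derivatives on the
right. -/
theorem exists_normal_form {R E σ : Type*} [CommRing R] [Ring E] [Algebra R E]
    (ξ δ : MvPolynomial σ R →ₐ[R] E)
    (hδξ : ∀ i p, δ (X i) * ξ p = ξ p * δ (X i) + ξ (pderiv i p)) {w : E}
    (hw : w ∈ Algebra.adjoin R
      ((Set.range fun i => ξ (X i)) ∪ Set.range fun i => δ (X i))) :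
    ∃ c : (σ →₀ ℕ) →₀ MvPolynomial σ R, w = c.sum fun α p => ξ p * δ (monomial α 1) := by
  let Φ : ((σ →₀ ℕ) →₀ MvPolynomial σ R) →ₗ[R] E :=
    Finsupp.lsum R fun α => LinearMap.mulRight R (δ (monomial α 1)) ∘ₗ ξ.toLinearMap
  have Φ_single : ∀ α p, Φ (Finsupp.single α p) = ξ p * δ (monomial α 1) := fun α p => by
    simp [Φ]
  suffices h : w ∈ LinearMap.range Φ by
    obtain ⟨c, rfl⟩ := h
    exact ⟨c, by simp only [Φ, Finsupp.lsum_apply]; rfl⟩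
  refine mem_of_mem_adjoin_of_mul_mem (S := LinearMap.range Φ) ⟨Finsupp.single 0 1, ?_⟩ ?_ hw
  · rw [Φ_single, map_one, one_mul]
    exact map_one δ
  · rintro a ha _ ⟨c, rfl⟩
    induction c using Finsupp.induction_linear with
    | zero => simp
    | add c c' hc hc' =>
      rw [map_add, mul_add]
      exact add_mem hc hc'
    | single α p =>
      rw [Φ_single, ← mul_assoc]
      rcases ha with ⟨i, rfl⟩ | ⟨i, rfl⟩
      · exact ⟨Finsupp.single α (X i * p), by rw [Φ_single, map_mul]⟩
      · refine ⟨Finsupp.single (Finsupp.single i 1 + α) p + Finsupp.single α (pderiv i p), ?_⟩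
        have h : (monomial (Finsupp.single i 1 + α) 1 : MvPolynomial σ R) =
            X i * monomial α 1 := by rw [X, monomial_mul, one_mul]
        rw [map_add, Φ_single, Φ_single, h, map_mul, hδξ, add_mul, mul_assoc]

/-- If left multiplication by `G` is compatible with the powers of `t`, elements of the algebra
generated by `G` and `t` are polynomials in `t` with coefficients on the right. -/
theorem exists_eq_sum_pow_mul {R E : Type*} [CommRing R] [Ring E] [Algebra R E]
    {G : Set E} {t : E} {W : Subalgebra R E}
    (hG : ∀ a ∈ G, ∀ j : ℕ, ∃ u ∈ W, ∃ v ∈ W, a * t ^ j = t ^ j * u + t ^ (j + 1) * v)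
    {a : E} (ha : a ∈ Algebra.adjoin R (G ∪ {t})) :
    ∃ (l : ℕ) (w : ℕ → E), (∀ j, w j ∈ W) ∧ a = ∑ j ∈ Finset.range (l + 1), t ^ j * w j := by
  let Φ : (ℕ →₀ W) →ₗ[R] E :=
    Finsupp.lsum R fun j => LinearMap.mulLeft R (t ^ j) ∘ₗ W.val.toLinearMap
  have Φ_single : ∀ j (w : W), Φ (Finsupp.single j w) = t ^ j * w := fun j w => by simp [Φ]
  suffices h : a ∈ LinearMap.range Φ by
    obtain ⟨c, rfl⟩ := h
    refine ⟨c.support.sup id, fun j => c j, fun j => (c j).2, ?_⟩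
    simp only [Φ, Finsupp.lsum_apply]
    exact Finsupp.sum_of_support_subset _ c.support.subset_range_sup_succ _ (by simp)
  refine mem_of_mem_adjoin_of_mul_mem (S := LinearMap.range Φ)
    ⟨Finsupp.single 0 1, by simp [Φ_single]⟩ ?_ ha
  rintro a ha _ ⟨c, rfl⟩
  induction c using Finsupp.induction_linear with
  | zero => simp
  | add c c' hc hc' =>
    rw [map_add, mul_add]
    exact add_mem hc hc'
  | single j w =>
    rw [Φ_single, ← mul_assoc]
    rcases ha with ha | rfl
    · obtain ⟨u, hu, v, hv, h⟩ := hG a ha j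
      refine ⟨Finsupp.single j (⟨u, hu⟩ * w) + Finsupp.single (j + 1) (⟨v, hv⟩ * w), ?_⟩
      rw [map_add, Φ_single, Φ_single, h, add_mul, mul_assoc, mul_assoc]
      rfl
    · exact ⟨Finsupp.single (j + 1) w, by rw [Φ_single, pow_succ']⟩

open scoped IsMulCommutative in
/-- Pairwise commuting elements of an algebra are the images of the variables under an algebra
homomorphism from a polynomial ring. -/
theorem exists_algHom_of_commute {R A σ : Type*} [CommRing R] [Ring A] [Algebra R A]
    (d : σ → A) (hd : ∀ i j, Commute (d i) (d j)) :
    ∃ δ : MvPolynomial σ R →ₐ[R] A, ∀ i, δ (X i) = d i := by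
  have hcomm : ∀ a ∈ Set.range d, ∀ b ∈ Set.range d, a * b = b * a := by
    rintro _ ⟨i, rfl⟩ _ ⟨j, rfl⟩
    exact hd i j
  have := Algebra.isMulCommutative_adjoin R hcomm
  let d' : σ → Algebra.adjoin R (Set.range d) :=
    fun i => ⟨d i, Algebra.subset_adjoin (Set.mem_range_self i)⟩
  refine ⟨(Algebra.adjoin R (Set.range d)).val.comp (aeval (R := R) d'), fun i => ?_⟩
  simp [d']

/-- A polynomial in characteristic zero with vanishing `T`-derivative involves only the
variables `x_i`. -/
theorem exists_rename_inl_eq_of_pderiv_inr_eq_zero {f : Qring K n}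
    (hfT : pderiv (Sum.inr ()) f = 0) :
    ∃ g : MvPolynomial (Fin n) K, rename Sum.inl g = f := by
  classical
  refine exists_rename_eq_of_vars_subset_range f _ Sum.inl_injective fun v hv => ?_
  rcases v with i | ⟨⟩
  · exact ⟨i, rfl⟩
  · obtain ⟨m, hm, hvm⟩ := mem_vars_iff_mem_support _ |>.1 hv
    have hle : Finsupp.single (Sum.inr ()) 1 ≤ m := by
      rw [Finsupp.single_le_iff]
      exact Nat.one_le_iff_ne_zero.2 (Finsupp.mem_support_iff.1 hvm)
    have h := coeff_pderiv (i := Sum.inr ()) f (m - Finsupp.single (Sum.inr ()) 1)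
    rw [hfT, tsub_add_cancel_of_le hle, coeff_zero, eq_comm, mul_eq_zero] at h
    rcases h with h | h
    · exact absurd h (mem_support_iff.1 hm)
    · exact absurd h (by norm_cast)

/-- The twisted partial derivative as a derivation. -/
def twistedDeriv (f : Qring K n) (i : Fin n) : Derivation K (Qring K n) (Qring K n) :=
  pderiv (Sum.inl i) - (pderiv (Sum.inl i) f * Tvar K n ^ 2) • pderiv (Sum.inr ())

theorem Dop_apply_s8 (f : Qring K n) (i : Fin n) (q : Qring K n) :
    Dop K n f i q = twistedDeriv K n f i q := rfl

theorem twistedDeriv_rename (f : Qring K n) (i : Fin n) (g : MvPolynomial (Fin n) K) :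
    twistedDeriv K n f i (rename Sum.inl g) = rename Sum.inl (pderiv i g) := by
  have h : pderiv (Sum.inr ()) (rename Sum.inl g : Qring K n) = 0 := by
    refine pderiv_eq_zero_of_notMem_vars fun hv => ?_
    classical
    simpa using vars_rename Sum.inl g hv
  simp [twistedDeriv, pderiv_rename Sum.inl_injective, h]

theorem twistedDeriv_Tvar (f : Qring K n) (i : Fin n) :
    twistedDeriv K n f i (Tvar K n) = -(pderiv (Sum.inl i) f * Tvar K n ^ 2) := by
  have h : pderiv (Sum.inl i) (Tvar K n) = 0 := pderiv_X_of_ne (by simp)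
  have h' : pderiv (Sum.inr ()) (Tvar K n) = 1 := pderiv_X_self _
  simp [twistedDeriv, h, h']

theorem twistedDeriv_comm (g : MvPolynomial (Fin n) K) (i j : Fin n) (q : Qring K n) :
    twistedDeriv K n (rename Sum.inl g) i (twistedDeriv K n (rename Sum.inl g) j q) =
      twistedDeriv K n (rename Sum.inl g) j (twistedDeriv K n (rename Sum.inl g) i q) := by
  have hpd : pderiv i (pderiv j g) = pderiv j (pderiv i g) := by
    have h : ⁅(pderiv i : Derivation K (MvPolynomial (Fin n) K) (MvPolynomial (Fin n) K)),
        pderiv (R := K) j⁆ = 0 := by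
      classical
      refine derivation_ext fun k => ?_
      simp [Derivation.commutator_apply, pderiv_X, Pi.single_apply, apply_ite]
    exact sub_eq_zero.1 (DFunLike.congr_fun h g)
  have h : ⁅twistedDeriv K n (rename Sum.inl g) i, twistedDeriv K n (rename Sum.inl g) j⁆ = 0 := by
    classical
    refine derivation_ext fun k => ?_
    rw [Derivation.commutator_apply, Derivation.zero_apply]
    rcases k with k | ⟨⟩
    · rw [← rename_X (R := K) Sum.inl k]
      simp only [twistedDeriv_rename]
      simp [pderiv_X, Pi.single_apply, apply_ite]
    · rw [show (X (Sum.inr PUnit.unit) : Qring K n) = Tvar K n from rfl]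
      simp only [twistedDeriv_Tvar, pderiv_rename Sum.inl_injective, map_neg, Derivation.leibniz,
        Derivation.leibniz_pow, twistedDeriv_rename, smul_eq_mul, nsmul_eq_mul, hpd]
      ring
  exact sub_eq_zero.1 (DFunLike.congr_fun h q)

/-- Multiplication by polynomials in the variables `x_i`. -/
def mulX : MvPolynomial (Fin n) K →ₐ[K] Module.End K (Qring K n) :=
  (Algebra.lmul K (Qring K n)).comp (rename Sum.inl)

theorem mulX_apply (p : MvPolynomial (Fin n) K) (q : Qring K n) :
    mulX K n p q = rename Sum.inl p * q := rfl

theorem mulX_X (i : Fin n) : mulX K n (X i) = mQ K n (X (Sum.inl i)) := by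
  refine LinearMap.ext fun q => ?_
  simp [mulX_apply, mQ]

theorem mulX_mem_Wsub (f : Qring K n) (p : MvPolynomial (Fin n) K) : mulX K n p ∈ Wsub K n f := by
  induction p using MvPolynomial.induction_on with
  | C a => exact (mulX K n).commutes a ▸ (Wsub K n f).algebraMap_mem a
  | add p q hp hq => exact map_add (mulX K n) p q ▸ add_mem hp hq
  | mul_X p i hp =>
    rw [map_mul, mulX_X]
    exact mul_mem hp (Algebra.subset_adjoin (Or.inl ⟨i, rfl⟩))

theorem Dop_mul_mulX (f : Qring K n) (i : Fin n) (p : MvPolynomial (Fin n) K) :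
    Dop K n f i * mulX K n p = mulX K n p * Dop K n f i + mulX K n (pderiv i p) := by
  refine LinearMap.ext fun q => ?_
  simp only [Module.End.mul_apply, LinearMap.add_apply, mulX_apply, Dop_apply_s8, Derivation.leibniz,
    twistedDeriv_rename, smul_eq_mul]
  ring

theorem Dop_mul_Tvar_pow (g : MvPolynomial (Fin n) K) (i : Fin n) (j : ℕ) :
    Dop K n (rename Sum.inl g) i * mQ K n (Tvar K n) ^ j =
      mQ K n (Tvar K n) ^ j * Dop K n (rename Sum.inl g) i +
        mQ K n (Tvar K n) ^ (j + 1) * mulX K n (-(j * pderiv i g)) := by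
  refine LinearMap.ext fun q => ?_
  simp only [mQ, LinearMap.pow_mulLeft, Module.End.mul_apply, LinearMap.add_apply, mulX_apply,
    Dop_apply_s8, LinearMap.mulLeft_apply, Derivation.leibniz, Derivation.leibniz_pow,
    twistedDeriv_Tvar, smul_eq_mul, nsmul_eq_mul, pderiv_rename Sum.inl_injective, map_mul,
    map_natCast, map_neg, LinearMap.neg_apply, Module.End.natCast_apply]
  cases j with
  | zero => simp
  | succ j => rw [Nat.add_sub_cancel]; ring

/-- Operators in `W` preserve the polynomials in the variables `x_i`. -/
theorem exists_rename_eq_apply_of_mem_Wsub {f : Qring K n} {w : Module.End K (Qring K n)}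
    (hw : w ∈ Wsub K n f) (g : MvPolynomial (Fin n) K) :
    ∃ h : MvPolynomial (Fin n) K, rename Sum.inl h = w (rename Sum.inl g) := by
  induction hw using Algebra.adjoin_induction generalizing g with
  | mem w hw =>
    rcases hw with ⟨i, rfl⟩ | ⟨i, rfl⟩
    · exact ⟨X i * g, by simp [mQ]⟩
    · exact ⟨pderiv i g, (twistedDeriv_rename K n f i g).symm⟩
  | algebraMap r => exact ⟨r • g, by simp [Module.algebraMap_end_apply]⟩
  | add v w _ _ hv hw =>
    obtain ⟨a, ha⟩ := hv g
    obtain ⟨b, hb⟩ := hw g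
    exact ⟨a + b, by simp [ha, hb]⟩
  | mul v w _ _ hv hw =>
    obtain ⟨b, hb⟩ := hw g
    obtain ⟨a, ha⟩ := hv b
    exact ⟨a, by rw [ha, hb, Module.End.mul_apply]⟩

/-- Iterated twisted derivatives of a monomial in the variables `x_i`. -/
theorem apply_rename_monomial {f : Qring K n}
    {δ : MvPolynomial (Fin n) K →ₐ[K] Module.End K (Qring K n)}
    (hδ : ∀ i, δ (X i) = Dop K n f i) (α β : Fin n →₀ ℕ) :
    δ (monomial α 1) (rename Sum.inl (monomial β 1)) =
      rename Sum.inl (monomial (β - α) (∏ k, ((β k).descFactorial (α k) : K))) := by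
  classical
  induction α using WellFoundedLT.induction with
  | ind α ih =>
    rcases eq_or_ne α 0 with rfl | hα
    · rw [monomial_zero', C_1, map_one]
      simp
    obtain ⟨i, hi⟩ := Finsupp.ne_iff.1 hα
    obtain ⟨γ, rfl⟩ := exists_add_of_le
      (Finsupp.single_le_iff.2 (Nat.one_le_iff_ne_zero.2 hi) : Finsupp.single i 1 ≤ α)
    have hX : (monomial (Finsupp.single i 1 + γ) 1 : MvPolynomial (Fin n) K) =
        X i * monomial γ 1 := by rw [X, monomial_mul, one_mul]
    have hprod : (∏ k, ((β k).descFactorial ((Finsupp.single i 1 + γ : Fin n →₀ ℕ) k) : K)) =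
        (∏ k, ((β k).descFactorial (γ k) : K)) * ((β - γ) i : ℕ) := by
      rw [← Finset.mul_prod_erase _ _ (Finset.mem_univ i),
        ← Finset.mul_prod_erase _ (fun k => ((β k).descFactorial (γ k) : K)) (Finset.mem_univ i),
        Finset.prod_congr rfl fun k hk => by
          rw [Finsupp.add_apply, Finsupp.single_eq_of_ne (Finset.ne_of_mem_erase hk), zero_add]]
      rw [Finsupp.add_apply, Finsupp.single_eq_same, add_comm 1, Nat.descFactorial_succ,
        Finsupp.tsub_apply]
      push_cast
      ring
    rw [hX, map_mul, Module.End.mul_apply, ih γ (lt_add_of_pos_left _ (by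
      simp [pos_iff_ne_zero])), hδ, Dop_apply_s8, twistedDeriv_rename, pderiv_monomial, hprod,
      tsub_tsub, add_comm γ]

/-- A nonzero operator in normal form acts nontrivially on the polynomials in the `x_i`. -/
theorem eq_zero_of_normal_form_apply_rename {f : Qring K n}
    {δ : MvPolynomial (Fin n) K →ₐ[K] Module.End K (Qring K n)}
    (hδ : ∀ i, δ (X i) = Dop K n f i) {c : (Fin n →₀ ℕ) →₀ MvPolynomial (Fin n) K}
    (hc : ∀ g, (c.sum fun α p => mulX K n p * δ (monomial α 1)) (rename Sum.inl g) = 0) :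
    c = 0 := by
  ext1 β
  rw [Finsupp.zero_apply]
  induction β using WellFoundedLT.induction with
  | ind β ih =>
    have h := hc (monomial β 1)
    rw [Finsupp.sum, LinearMap.sum_apply, Finset.sum_eq_single β] at h
    · rw [Module.End.mul_apply, mulX_apply, apply_rename_monomial K n hδ, ← map_mul,
        map_eq_zero_iff _ (rename_injective _ Sum.inl_injective), mul_eq_zero] at h
      refine h.resolve_right ?_
      simp [Finset.prod_eq_zero_iff, Nat.descFactorial_self,
        Nat.factorial_ne_zero]
    · intro α _ hαβ
      rw [Module.End.mul_apply, mulX_apply, apply_rename_monomial K n hδ]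
      by_cases hle : α ≤ β
      · rw [ih α (lt_of_le_of_ne hle hαβ), map_zero, zero_mul]
      · obtain ⟨k, hk⟩ := not_forall.1 hle
        rw [Finset.prod_eq_zero (Finset.mem_univ k), monomial_zero, map_zero, mul_zero]
        rw [Nat.descFactorial_eq_zero_iff_lt.2 (not_le.1 hk), Nat.cast_zero]
    · intro hβ
      rw [Finsupp.notMem_support_iff.1 hβ, map_zero, zero_mul, LinearMap.zero_apply]

/-- The powers of `T` are linearly independent over the polynomials in the variables `x_i`. -/
theorem eq_zero_of_sum_Tvar_pow_mul_rename {s : Finset ℕ} {h : ℕ → MvPolynomial (Fin n) K}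
    (hs : ∑ j ∈ s, Tvar K n ^ j * rename Sum.inl (h j) = 0) {j : ℕ} (hj : j ∈ s) : h j = 0 := by
  let φ : Qring K n →ₐ[K] Polynomial (MvPolynomial (Fin n) K) :=
    aeval (Sum.elim (fun i => Polynomial.C (X i)) fun _ => Polynomial.X)
  have hφ : ∀ g : MvPolynomial (Fin n) K, φ (rename Sum.inl g) = Polynomial.C g := by
    intro g
    have : φ.comp (rename Sum.inl) =
        (IsScalarTower.toAlgHom K (MvPolynomial (Fin n) K) _) := by
      ext i
      simp [φ]
    exact DFunLike.congr_fun this g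
  have hT : φ (Tvar K n) = Polynomial.X := by simp [φ, Tvar]
  have hcoeff := congrArg (fun q => (φ q).coeff j) hs
  simpa [map_sum, hφ, hT, Polynomial.finsetSum_coeff, Polynomial.coeff_X_pow, hj] using hcoeff

/-- Every element of `A = W_x[T]` is a finite sum `Σ_j m_T^j ∘ w_j` with `w_j ∈ W_x`,
and this representation is unique. -/
theorem powers_of_T_basis
    (hn : 0 < n) (f : Qring K n) (hfT : pderiv (Sum.inr ()) f = 0) :
    (∀ a ∈ Asub K n f, ∃ (ℓ : ℕ) (w : ℕ → Module.End K (Qring K n)),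
        (∀ j, w j ∈ Wsub K n f) ∧
        a = ∑ j ∈ Finset.range (ℓ + 1), mQ K n (Tvar K n) ^ j * w j) ∧
    (∀ (ℓ : ℕ) (w : ℕ → Module.End K (Qring K n)),
        (∀ j, w j ∈ Wsub K n f) →
        ∑ j ∈ Finset.range (ℓ + 1), mQ K n (Tvar K n) ^ j * w j = 0 →
        ∀ j ∈ Finset.range (ℓ + 1), w j = 0) := by
  obtain ⟨g, rfl⟩ := exists_rename_inl_eq_of_pderiv_inr_eq_zero K n hfT
  refine ⟨fun a ha => exists_eq_sum_pow_mul ?_ ha, fun ℓ w hw hsum j hj => ?_⟩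
  · rintro _ (⟨i, rfl⟩ | ⟨i, rfl⟩) j
    · refine ⟨_, Algebra.subset_adjoin (Or.inl ⟨i, rfl⟩), 0, zero_mem _, ?_⟩
      refine LinearMap.ext fun q => ?_
      simp [mQ, LinearMap.pow_mulLeft, mul_left_comm]
    · refine ⟨_, Algebra.subset_adjoin (Or.inr ⟨i, rfl⟩), _,
        mulX_mem_Wsub K n _ _, Dop_mul_Tvar_pow K n g i j⟩
  · obtain ⟨δ, hδ⟩ := exists_algHom_of_commute (R := K) (Dop K n (rename Sum.inl g))
      fun i k => LinearMap.ext fun q => twistedDeriv_comm K n g i k q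
    have hwx : ∀ p, w j (rename Sum.inl p) = 0 := by
      intro p
      choose h hh using fun k => exists_rename_eq_apply_of_mem_Wsub K n (hw k) p
      rw [← hh, eq_zero_of_sum_Tvar_pow_mul_rename K n (h := h) ?_ hj, map_zero]
      simpa [mQ, LinearMap.pow_mulLeft, hh] using LinearMap.congr_fun hsum (rename Sum.inl p)
    obtain ⟨c, hc⟩ := exists_normal_form (mulX K n) δ (w := w j)
      (fun i p => by rw [hδ, Dop_mul_mulX]) (by simp only [mulX_X, hδ]; exact hw j)
    rw [hc] at hwx ⊢
    rw [eq_zero_of_normal_form_apply_rename K n hδ hwx, Finsupp.sum_zero_index]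

end
end

section
/- Let K be a field of characteristic zero, n a positive integer, P := MvPolynomial (Fin n) K, and f ∈ P nonzero; let B := Localization.Away f. For each i ∈ Fin n, let d_i : B → B be a K-derivation satisfying d_i (algebraMap P B p) = algebraMap P B (pderiv i p) for all p ∈ P. Let M be a B-module that is finitely generated over B, equipped with additive maps D_i : M → M (i ∈ Fin n) satisfying the Leibniz rule D_i (b • m) = b • D_i m + (d_i b) • m for all b ∈ B, m ∈ M. Then M is torsion-free over B: for every nonzero b ∈ B and every m ∈ M, b • m = 0 implies m = 0. -/
set_option synthInstance.maxHeartbeats 1000000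
set_option maxHeartbeats 1000000

namespace MvPolynomial

variable {σ R : Type*} [CommSemiring R]

theorem totalDegree_pderiv_lt {p : MvPolynomial σ R} {i : σ} (h : pderiv i p ≠ 0) :
    (pderiv i p).totalDegree < p.totalDegree := by
  obtain ⟨m, hm, hdeg⟩ :=
    Finset.exists_mem_eq_sup _ (support_nonempty.mpr h) (fun s : σ →₀ ℕ => s.sum fun _ e => e)
  rw [mem_support_iff, coeff_pderiv] at hm
  have hle := le_totalDegree (mem_support_iff.mpr (left_ne_zero_of_mul hm))
  rw [Finsupp.sum_add_index' (by simp) (by simp), Finsupp.sum_single_index rfl] at hle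
  rw [totalDegree, hdeg]
  lia

theorem eq_C_of_pderiv_eq_zero [NoZeroDivisors R] [CharZero R] {p : MvPolynomial σ R}
    (h : ∀ i, pderiv i p = 0) : p = C (coeff 0 p) := by
  classical
  ext m
  rw [coeff_C]
  split_ifs with hm
  · rw [hm]
  obtain ⟨i, hi⟩ := Finsupp.ne_iff.mp (Ne.symm hm)
  have hcoeff := congrArg (coeff (m - Finsupp.single i 1)) (h i)
  rw [coeff_pderiv, Finsupp.sub_add_single_one_cancel hi, coeff_zero] at hcoeff
  exact (mul_eq_zero.mp hcoeff).resolve_right (Nat.cast_add_one_ne_zero _)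

/-- In characteristic zero, a polynomial ring over a field has no proper nonzero ideal stable under
all partial derivatives. -/
theorem ideal_eq_top_of_pderiv_mem {σ K : Type*} [Field K] [CharZero K]
    {I : Ideal (MvPolynomial σ K)} (hI : I ≠ ⊥) (h : ∀ i, ∀ p ∈ I, pderiv i p ∈ I) : I = ⊤ := by
  suffices H : ∀ k, ∀ p ∈ I, p ≠ 0 → p.totalDegree = k → I = ⊤ by
    obtain ⟨p, hp, hp0⟩ := Submodule.exists_mem_ne_zero_of_ne_bot hI
    exact H _ p hp hp0 rfl
  intro k
  induction k using Nat.strong_induction_on with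
  | _ k ih =>
    intro p hp hp0 hk
    by_cases hd : ∀ i, pderiv i p = 0
    · have hC := eq_C_of_pderiv_eq_zero hd
      refine I.eq_top_of_isUnit_mem hp ?_
      rw [hC]
      refine (IsUnit.mk0 _ fun h0 => hp0 ?_).map C
      rw [hC, h0, C_0]
    · push Not at hd
      obtain ⟨i, hi⟩ := hd
      exact ih _ (hk ▸ totalDegree_pderiv_lt hi) _ (h i p hp) hi rfl

end MvPolynomial

section Connection

variable {B M : Type*} [CommRing B] [AddCommGroup M] [Module B M] {δ : B → B} {D : M →+ M}

theorem Submodule.map_mem_torsion_of_leibniz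
    (hD : ∀ (b : B) (m : M), D (b • m) = b • D m + δ b • m) {m : M}
    (hm : m ∈ Submodule.torsion B M) : D m ∈ Submodule.torsion B M := by
  obtain ⟨a, ha⟩ := (Submodule.mem_torsion_iff m).mp hm
  have ha' : (a : B) • m = 0 := ha
  refine (Submodule.mem_torsion_iff _).mpr ⟨a * a, ?_⟩
  have h := congrArg ((a : B) • ·) (hD a m)
  simp only [ha', map_zero, smul_zero, smul_add] at h
  rw [smul_comm (a : B) (δ a) m, ha', smul_zero, add_zero] at h
  rw [mul_smul]
  exact h.symm

theorem Submodule.map_mem_annihilator_of_leibniz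
    (hD : ∀ (b : B) (m : M), D (b • m) = b • D m + δ b • m) {N : Submodule B M}
    (hN : ∀ m ∈ N, D m ∈ N) {b : B} (hb : b ∈ N.annihilator) : δ b ∈ N.annihilator := by
  rw [Submodule.mem_annihilator] at hb ⊢
  intro m hm
  have h := hD b m
  rwa [hb m hm, hb _ (hN m hm), map_zero, zero_add, eq_comm] at h

end Connection

/-- A finitely generated module over `K[x][1/f]` carrying a connection
(compatible actions of the partial derivatives) is torsion-free. -/
theorem torsionFree_of_connection
    (K : Type*) [Field K] [CharZero K] (n : ℕ) (hn : 0 < n)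
    (f : MvPolynomial (Fin n) K) (hf : f ≠ 0)
    (d : Fin n → Derivation K (Localization.Away f) (Localization.Away f))
    (hd : ∀ (i : Fin n) (p : MvPolynomial (Fin n) K),
      d i (algebraMap (MvPolynomial (Fin n) K) (Localization.Away f) p) =
        algebraMap (MvPolynomial (Fin n) K) (Localization.Away f) (MvPolynomial.pderiv i p))
    (M : Type*) [AddCommGroup M] [Module (Localization.Away f) M]
    [Module.Finite (Localization.Away f) M]
    (D : Fin n → M →+ M)
    (hD : ∀ (i : Fin n) (b : Localization.Away f) (m : M),
      D i (b • m) = b • D i m + d i b • m) :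
    ∀ b : Localization.Away f, b ≠ 0 → ∀ m : M, b • m = 0 → m = 0 := by
  have hle := powers_le_nonZeroDivisors_of_noZeroDivisors hf
  have : IsDomain (Localization.Away f) := IsLocalization.isDomain_localization hle
  have : IsNoetherianRing (Localization.Away f) :=
    IsLocalization.isNoetherianRing (Submonoid.powers f) _ inferInstance
  set T := Submodule.torsion (Localization.Away f) M
  set J := T.annihilator.comap (algebraMap (MvPolynomial (Fin n) K) (Localization.Away f))
  have hJ : J ≠ ⊥ := by
    obtain ⟨a, ha, ha0⟩ := Submodule.annihilator_top_inter_nonZeroDivisors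
      (Submodule.torsion_isTorsion (R := Localization.Away f) (M := M))
    have haT : a ∈ T.annihilator := by
      rw [Submodule.mem_annihilator]
      intro t ht
      exact congrArg Subtype.val (Submodule.mem_annihilator.mp ha ⟨t, ht⟩ trivial)
    obtain ⟨⟨p, s⟩, hp⟩ := IsLocalization.surj (Submonoid.powers f) a
    refine (Submodule.ne_bot_iff _).mpr ⟨p, ?_, ?_⟩
    · rw [Ideal.mem_comap, ← hp]
      exact Ideal.mul_mem_right _ _ haT
    · rintro rfl
      rw [map_zero] at hp
      refine nonZeroDivisors.ne_zero ha0 ((mul_eq_zero.mp hp).resolve_right ?_)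
      exact (IsLocalization.map_units (Localization.Away f) s).ne_zero
  have hJ_top : J = ⊤ := MvPolynomial.ideal_eq_top_of_pderiv_mem hJ fun i p hp => by
    rw [Ideal.mem_comap, ← hd]
    exact Submodule.map_mem_annihilator_of_leibniz (hD i)
      (fun _ => Submodule.map_mem_torsion_of_leibniz (hD i)) hp
  intro b hb m hm
  have h1 := (Ideal.eq_top_iff_one J).mp hJ_top
  rw [Ideal.mem_comap, map_one, Submodule.mem_annihilator] at h1
  rw [← one_smul (Localization.Away f) m]
  exact h1 m ((Submodule.mem_torsion_iff m).mpr ⟨⟨b, mem_nonZeroDivisors_of_ne_zero hb⟩, hm⟩)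
end
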